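/- Let m ≥ 4 be an integer and let q* be the m-dimensional probability vector (1/m, …, 1/m). Then λ(q*) ≤ 10/m; equivalently, ∑_{n=1}^∞ ∑_{l_1+⋯+l_m = n, l_i ≥ 0} ( n!/(l_1!⋯l_m!) )² · m^{−2n} ≤ 10/m. -/

import Mathlib

/-- `λ(q)` for a `d`-dimensional probability vector `q`: the expected number of
meetings (at positive times) of two independent oriented random walks associated to `q`,
given by the explicit formula
`λ(q) = ∑_{n ≥ 1} ∑_{l₁+⋯+l_d = n} ( (n!/(l₁!⋯l_d!)) · q₁^{l₁}⋯q_d^{l_d} )²`. -/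
noncomputable def lambdaRW (d : ℕ) (q : Fin d → ℝ) : ENNReal :=
  ∑' n : ℕ, ∑ l ∈ Finset.Nat.antidiagonalTuple d (n + 1),
    ENNReal.ofReal (((Nat.multinomial Finset.univ l : ℝ) * ∏ i, q i ^ l i) ^ 2)

/-- The collision probability of two independent uniform oriented walks on `ℤ^m` at time `n`. -/
noncomputable def collisionProb (m n : ℕ) : ℝ :=
  ∑ l ∈ Finset.Nat.antidiagonalTuple m n,
    (Nat.multinomial Finset.univ l : ℝ) ^ 2 * ((m : ℝ) ^ (2 * n))⁻¹

/-- The probability that the uniform oriented walk on `ℤ^m` visits `(k, …, k)`. -/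
noncomputable def diagonalProb (m k : ℕ) : ℝ :=
  ((k * m).factorial : ℝ) / ((k.factorial : ℝ) ^ m * (m : ℝ) ^ (k * m))

lemma diagonalProb_nonneg (m k : ℕ) : 0 ≤ diagonalProb m k := by
  unfold diagonalProb; positivity

lemma factorial_add_le_factorial_mul_pow {a j N : ℕ} (h : a + j ≤ N) :
    (a + j).factorial ≤ a.factorial * N ^ j := by
  rw [← Nat.factorial_mul_ascFactorial]
  exact Nat.mul_le_mul_left _
    ((Nat.ascFactorial_le_pow_add a j).trans (Nat.pow_le_pow_left h j))

lemma factorial_mul_succ_pow_le (k l : ℕ) :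
    k.factorial * (k + 1) ^ l ≤ l.factorial * (k + 1) ^ k := by
  rcases le_total k l with h | h
  · obtain ⟨j, rfl⟩ := Nat.exists_eq_add_of_le h
    rw [pow_add, mul_left_comm, mul_comm ((k + j).factorial)]
    exact Nat.mul_le_mul_left _ Nat.factorial_mul_pow_le_factorial
  · obtain ⟨j, rfl⟩ := Nat.exists_eq_add_of_le h
    rw [pow_add, mul_left_comm, mul_comm ((l + j).factorial)]
    exact Nat.mul_le_mul_left _ (factorial_add_le_factorial_mul_pow (Nat.le_succ _))

/-- Between times `k * m` and `(k + 1) * m`, no point is hit with probability larger than the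
probability of being at `(k, …, k)` at time `k * m`. -/
lemma multinomial_div_pow_le_diagonalProb {m k r : ℕ} (hm : 0 < m) (hr : r ≤ m) (l : Fin m → ℕ)
    (hl : ∑ i, l i = k * m + r) :
    (Nat.multinomial Finset.univ l : ℝ) / (m : ℝ) ^ (k * m + r) ≤ diagonalProb m k := by
  have hprod : k.factorial ^ m * (k + 1) ^ r ≤ ∏ i, (l i).factorial := by
    have h := Finset.prod_le_prod' (s := Finset.univ)
      fun i _ => factorial_mul_succ_pow_le k (l i)
    simp only [Finset.prod_mul_distrib, Finset.prod_const, Finset.card_univ, Fintype.card_fin,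
      Finset.prod_pow_eq_pow_sum, hl] at h
    rw [← pow_mul, pow_add, mul_left_comm, mul_comm _ ((k + 1) ^ (k * m))] at h
    exact Nat.le_of_mul_le_mul_left h (by positivity)
  have hfac : (k * m + r).factorial ≤ (k * m).factorial * ((k + 1) * m) ^ r :=
    factorial_add_le_factorial_mul_pow (by nlinarith)
  have hspec := Nat.multinomial_spec Finset.univ l
  rw [hl] at hspec
  have key : k.factorial ^ m * Nat.multinomial Finset.univ l ≤ (k * m).factorial * m ^ r := by
    refine le_of_mul_le_mul_left ?_ (by positivity : 0 < (k + 1) ^ r)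
    calc (k + 1) ^ r * (k.factorial ^ m * Nat.multinomial Finset.univ l)
        = (k.factorial ^ m * (k + 1) ^ r) * Nat.multinomial Finset.univ l := by ring
      _ ≤ (∏ i, (l i).factorial) * Nat.multinomial Finset.univ l := Nat.mul_le_mul_right _ hprod
      _ = (k * m + r).factorial := hspec
      _ ≤ (k * m).factorial * ((k + 1) * m) ^ r := hfac
      _ = (k + 1) ^ r * ((k * m).factorial * m ^ r) := by rw [mul_pow]; ring
  have key' : (k.factorial : ℝ) ^ m * Nat.multinomial Finset.univ l
      ≤ (k * m).factorial * (m : ℝ) ^ r := by exact_mod_cast key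
  have hm' : (0 : ℝ) < m := by exact_mod_cast hm
  unfold diagonalProb
  rw [div_le_div_iff₀ (by positivity) (by positivity), pow_add]
  calc (Nat.multinomial Finset.univ l : ℝ) * ((k.factorial : ℝ) ^ m * (m : ℝ) ^ (k * m))
      = ((k.factorial : ℝ) ^ m * Nat.multinomial Finset.univ l) * (m : ℝ) ^ (k * m) := by ring
    _ ≤ ((k * m).factorial * (m : ℝ) ^ r) * (m : ℝ) ^ (k * m) := by gcongr
    _ = _ := by ring

lemma sum_multinomial_antidiagonalTuple (m n : ℕ) :
    ∑ l ∈ Finset.Nat.antidiagonalTuple m n, (Nat.multinomial Finset.univ l : ℝ) = (m : ℝ) ^ n := by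
  have h := Finset.sum_pow_eq_sum_piAntidiag (Finset.univ : Finset (Fin m)) (fun _ => (1 : ℝ)) n
  simp only [Finset.sum_const, Finset.card_univ, Fintype.card_fin, nsmul_eq_mul, mul_one, one_pow,
    Finset.prod_const_one] at h
  rw [h]
  refine Finset.sum_congr ?_ fun _ _ => rfl
  ext l
  simp [Finset.Nat.mem_antidiagonalTuple]

/-- The collision probability is at most the largest point probability. -/
lemma collisionProb_le_of_forall_le {m n : ℕ} (hm : 0 < m) {c : ℝ}
    (h : ∀ l : Fin m → ℕ, ∑ i, l i = n → (Nat.multinomial Finset.univ l : ℝ) / (m : ℝ) ^ n ≤ c) :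
    collisionProb m n ≤ c := by
  have hm' : (0 : ℝ) < m := by exact_mod_cast hm
  calc collisionProb m n
      ≤ ∑ l ∈ Finset.Nat.antidiagonalTuple m n,
          c * ((Nat.multinomial Finset.univ l : ℝ) / (m : ℝ) ^ n) := by
        refine Finset.sum_le_sum fun l hl => ?_
        have := h l (Finset.Nat.mem_antidiagonalTuple.1 hl)
        rw [mul_comm 2 n, pow_mul, ← div_eq_mul_inv, ← div_pow, sq]
        gcongr
    _ = c := by
        rw [← Finset.mul_sum, ← Finset.sum_div, sum_multinomial_antidiagonalTuple,
          div_self (by positivity), mul_one]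

lemma collisionProb_le_diagonalProb {m k r : ℕ} (hm : 0 < m) (hr : r ≤ m) :
    collisionProb m (k * m + r) ≤ diagonalProb m k :=
  collisionProb_le_of_forall_le hm (multinomial_div_pow_le_diagonalProb hm hr)

lemma collisionProb_le_factorial_div_pow {m : ℕ} (n : ℕ) (hm : 0 < m) :
    collisionProb m n ≤ (n.factorial : ℝ) / (m : ℝ) ^ n := by
  refine collisionProb_le_of_forall_le hm fun l hl => ?_
  have hspec := Nat.multinomial_spec Finset.univ l
  rw [hl] at hspec
  have : Nat.multinomial Finset.univ l ≤ n.factorial := by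
    rw [← hspec]
    exact Nat.le_mul_of_pos_left _ (Finset.prod_pos fun i _ => Nat.factorial_pos _)
  gcongr

lemma sum_collisionProb_range_le {m : ℕ} (hm : 0 < m) :
    ∑ r ∈ Finset.range m, collisionProb m (r + 1) ≤ 3 / m := by
  obtain ⟨p, rfl⟩ := Nat.exists_eq_succ_of_ne_zero hm.ne'
  have hp : (0 : ℝ) < (p.succ : ℕ) := by exact_mod_cast hm
  rw [Finset.sum_range_succ']
  have h1 : collisionProb p.succ (0 + 1) ≤ 1 / (p.succ : ℕ) := by
    simpa using collisionProb_le_factorial_div_pow 1 hm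
  have h2 : ∀ r ∈ Finset.range p,
      collisionProb p.succ (r + 1 + 1) ≤ 2 / ((p.succ : ℕ) : ℝ) ^ 2 := by
    intro r hr
    refine (collisionProb_le_factorial_div_pow _ hm).trans ?_
    have : (2 + r).factorial ≤ Nat.factorial 2 * p.succ ^ r :=
      factorial_add_le_factorial_mul_pow (by have := Finset.mem_range.1 hr; omega)
    rw [show r + 1 + 1 = 2 + r by ring, div_le_div_iff₀ (by positivity) (by positivity), pow_add]
    have h' : ((2 + r).factorial : ℝ) ≤ 2 * ((p.succ : ℕ) : ℝ) ^ r := by exact_mod_cast this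
    nlinarith [mul_le_mul_of_nonneg_right h' (sq_nonneg ((p.succ : ℕ) : ℝ))]
  have h3 := Finset.sum_le_card_nsmul _ _ _ h2
  rw [Finset.card_range, nsmul_eq_mul] at h3
  have h4 : (p : ℝ) * (2 / ((p.succ : ℕ) : ℝ) ^ 2) ≤ 2 / (p.succ : ℕ) := by
    rw [mul_div_assoc', div_le_div_iff₀ (by positivity) hp]
    push_cast
    nlinarith [(Nat.cast_nonneg p : (0 : ℝ) ≤ p)]
  have h5 : (3 : ℝ) / (p.succ : ℕ) = 2 / (p.succ : ℕ) + 1 / (p.succ : ℕ) := by ring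
  linarith

/-- Pairing the `j`-th and the `(p - 1 - j)`-th factor bounds the product of an arithmetic
progression by a power of its mean. -/
lemma prod_range_add_le_mean_pow (a : ℝ) (ha : 0 ≤ a) (p : ℕ) :
    ∏ j ∈ Finset.range p, (a + 1 + j) ≤ (a + (p + 1) / 2) ^ p := by
  refine le_of_pow_le_pow_left₀ two_ne_zero (by positivity) ?_
  calc (∏ j ∈ Finset.range p, (a + 1 + j)) ^ 2
      = ∏ j ∈ Finset.range p, ((a + 1 + j) * (a + 1 + (p - 1 - j : ℕ))) := by
        rw [Finset.prod_mul_distrib, Finset.prod_range_reflect (fun j : ℕ => a + 1 + (j : ℝ)), sq]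
    _ ≤ ∏ _j ∈ Finset.range p, (a + (p + 1) / 2) ^ 2 := by
        refine Finset.prod_le_prod (fun j _ => by positivity) fun j hj => ?_
        have hcast : ((p - 1 - j : ℕ) : ℝ) = p - 1 - j := by
          have hjp := Finset.mem_range.1 hj
          rw [Nat.cast_sub (by omega), Nat.cast_sub (by omega), Nat.cast_one]
        rw [hcast]
        nlinarith [sq_nonneg ((2 * j : ℝ) + 1 - p)]
    _ = ((a + (p + 1) / 2) ^ p) ^ 2 := by
        rw [Finset.prod_const, Finset.card_range, pow_right_comm]

lemma diagonalProb_succ_le {m : ℕ} (hm : 4 ≤ m) (k : ℕ) :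
    diagonalProb m (k + 1) ≤ ((2 * k + 1) / (2 * k + 2) : ℝ) ^ 3 * diagonalProb m k := by
  have hm' : (0 : ℝ) < m := by exact_mod_cast (by omega : 0 < m)
  have hasc : (((k + 1) * m).factorial : ℝ) ≤
      (k * m).factorial * (((2 * k + 1) / (2 * k + 2) : ℝ) ^ 3 * ((k + 1) * m) ^ m) := by
    obtain ⟨p, rfl⟩ : ∃ p, m = p + 1 := ⟨m - 1, by omega⟩
    set x : ℝ := (2 * k + 1) / (2 * k + 2) with hx
    have hx0 : 0 ≤ x := by positivity
    have hx1 : x ≤ 1 := by rw [hx, div_le_one (by positivity)]; linarith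
    rw [add_one_mul k, ← Nat.factorial_mul_ascFactorial, Nat.ascFactorial_eq_prod_range]
    push_cast
    gcongr
    rw [Finset.prod_range_succ]
    have hmean := prod_range_add_le_mean_pow ((k : ℝ) * (p + 1)) (by positivity) p
    have heq : (k : ℝ) * (p + 1) + (p + 1) / 2 = x * ((k + 1) * (p + 1)) := by
      rw [hx]; field_simp
    rw [heq, mul_pow] at hmean
    calc _ ≤ (x ^ p * ((k + 1) * (p + 1) : ℝ) ^ p) * (k * (p + 1) + 1 + p) := by gcongr
      _ ≤ (x ^ 3 * ((k + 1) * (p + 1) : ℝ) ^ p) * (k * (p + 1) + 1 + p) := by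
          gcongr ?_ * _ * _
          exact pow_le_pow_of_le_one hx0 hx1 (by omega)
      _ = _ := by ring
  unfold diagonalProb
  rw [mul_div_assoc', div_le_div_iff₀ (by positivity) (by positivity)]
  calc _ ≤ ((k * m).factorial * (((2 * k + 1) / (2 * k + 2) : ℝ) ^ 3 * ((k + 1) * m) ^ m)) *
        ((k.factorial : ℝ) ^ m * (m : ℝ) ^ (k * m)) := by gcongr
    _ = _ := by
      rw [Nat.factorial_succ, add_one_mul k m, pow_add]
      push_cast
      rw [mul_pow, mul_pow]
      ring

lemma diagonalProb_le_telescope {m : ℕ} (hm : 4 ≤ m) (k : ℕ) :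
    diagonalProb m k ≤
      (2 * k + 2) * diagonalProb m k - (2 * (k + 1 : ℕ) + 2) * diagonalProb m (k + 1) := by
  have h := mul_le_mul_of_nonneg_left (diagonalProb_succ_le hm k)
    (by positivity : (0 : ℝ) ≤ 2 * (k + 1 : ℕ) + 2)
  have hk : (0 : ℝ) ≤ k := k.cast_nonneg
  have hc : (2 * (k + 1 : ℕ) + 2 : ℝ) * ((2 * k + 1) / (2 * k + 2) : ℝ) ^ 3 ≤ 2 * k + 1 := by
    rw [div_pow, mul_div_assoc', div_le_iff₀ (by positivity)]
    push_cast
    have : 0 ≤ (2 * (k : ℝ) + 1) * (6 * k + 4) := by positivity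
    nlinarith
  have := mul_le_mul_of_nonneg_right hc (diagonalProb_nonneg m k)
  nlinarith

lemma sum_collisionProb_le {m : ℕ} (hm : 4 ≤ m) (K : ℕ) :
    ∑ n ∈ Finset.range ((K + 1) * m), collisionProb m (n + 1) ≤
      3 / m + m * (4 * diagonalProb m 1 - (2 * (K + 1 : ℕ) + 2) * diagonalProb m (K + 1)) := by
  induction K with
  | zero =>
    have := sum_collisionProb_range_le (by omega : 0 < m)
    rw [zero_add, one_mul]
    push_cast
    linarith
  | succ K ih =>
    rw [add_one_mul (K + 1) m, Finset.sum_range_add]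
    have hblock : ∑ r ∈ Finset.range m, collisionProb m ((K + 1) * m + r + 1) ≤
        m * diagonalProb m (K + 1) := by
      refine (Finset.sum_le_card_nsmul _ _ (diagonalProb m (K + 1)) fun r hr => ?_).trans_eq ?_
      · exact collisionProb_le_diagonalProb (r := r + 1) (by omega) (Finset.mem_range.1 hr)
      · rw [Finset.card_range, nsmul_eq_mul]
    have htel := mul_le_mul_of_nonneg_left (diagonalProb_le_telescope hm (K + 1))
      (Nat.cast_nonneg m : (0 : ℝ) ≤ m)
    linarith

lemma diagonalProb_one_le {m : ℕ} (hm : 4 ≤ m) : diagonalProb m 1 ≤ 24 / (m : ℝ) ^ 4 := by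
  obtain ⟨j, rfl⟩ := Nat.exists_eq_add_of_le hm
  have h : (4 + j).factorial ≤ Nat.factorial 4 * (4 + j) ^ j :=
    factorial_add_le_factorial_mul_pow le_rfl
  have h' : ((4 + j).factorial : ℝ) ≤ 24 * ((4 + j : ℕ) : ℝ) ^ j := by exact_mod_cast h
  unfold diagonalProb
  rw [div_le_div_iff₀ (by positivity) (by positivity), one_mul, Nat.factorial_one, Nat.cast_one,
    one_pow, one_mul, pow_add]
  nlinarith [mul_le_mul_of_nonneg_right h' (by positivity : 0 ≤ ((4 + j : ℕ) : ℝ) ^ 4)]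

lemma collisionProb_nonneg (m n : ℕ) : 0 ≤ collisionProb m n :=
  Finset.sum_nonneg fun _ _ => by positivity

lemma sum_range_collisionProb_le {m : ℕ} (hm : 4 ≤ m) (N : ℕ) :
    ∑ n ∈ Finset.range N, collisionProb m (n + 1) ≤ 10 / m := by
  have hm' : (4 : ℝ) ≤ m := by exact_mod_cast hm
  have hsub : Finset.range N ⊆ Finset.range ((N + 1) * m) :=
    Finset.range_subset_range.2 (by nlinarith)
  have hmono := Finset.sum_le_sum_of_subset_of_nonneg hsub
    fun n _ _ => collisionProb_nonneg m (n + 1)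
  have hrest : 0 ≤ (m : ℝ) * ((2 * (N + 1 : ℕ) + 2) * diagonalProb m (N + 1)) :=
    mul_nonneg (by positivity) (mul_nonneg (by positivity) (diagonalProb_nonneg _ _))
  have hfirst : (m : ℝ) * (4 * diagonalProb m 1) ≤ 7 / m := by
    calc (m : ℝ) * (4 * diagonalProb m 1) ≤ m * (4 * (24 / (m : ℝ) ^ 4)) := by
          gcongr; exact diagonalProb_one_le hm
      _ = 96 / (m : ℝ) ^ 2 / m := by field_simp; norm_num
      _ ≤ 7 / m := by
          gcongr
          rw [div_le_iff₀ (by positivity)]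
          nlinarith
  have hsum := sum_collisionProb_le hm N
  have : (10 : ℝ) / m = 3 / m + 7 / m := by ring
  linarith

lemma lambdaRW_uniform (m : ℕ) :
    lambdaRW m (fun _ => 1 / (m : ℝ)) =
      ∑' n : ℕ, ∑ l ∈ Finset.Nat.antidiagonalTuple m (n + 1),
        ENNReal.ofReal ((Nat.multinomial Finset.univ l : ℝ) ^ 2 * ((m : ℝ) ^ (2 * (n + 1)))⁻¹) := by
  unfold lambdaRW
  refine tsum_congr fun n => Finset.sum_congr rfl fun l hl => ?_
  rw [Finset.prod_pow_eq_pow_sum, Finset.Nat.mem_antidiagonalTuple.1 hl, mul_pow, ← pow_mul,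
    one_div, inv_pow, mul_comm (n + 1) 2]

theorem lambda_uniform_le (m : ℕ) (hm : 4 ≤ m) :
    lambdaRW m (fun _ => 1 / (m : ℝ)) ≤ ENNReal.ofReal (10 / (m : ℝ)) ∧
      (∑' n : ℕ, ∑ l ∈ Finset.Nat.antidiagonalTuple m (n + 1),
          ENNReal.ofReal (((Nat.multinomial Finset.univ l : ℝ)) ^ 2 * ((m : ℝ) ^ (2 * (n + 1)))⁻¹))
        ≤ ENNReal.ofReal (10 / (m : ℝ)) := by
  rw [lambdaRW_uniform, and_self]
  refine ENNReal.tsum_le_of_sum_range_le fun N => ?_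
  calc _ = ∑ n ∈ Finset.range N, ENNReal.ofReal (collisionProb m (n + 1)) :=
        Finset.sum_congr rfl fun n _ =>
          (ENNReal.ofReal_sum_of_nonneg fun _ _ => by positivity).symm
    _ = ENNReal.ofReal (∑ n ∈ Finset.range N, collisionProb m (n + 1)) :=
        (ENNReal.ofReal_sum_of_nonneg fun n _ => collisionProb_nonneg m (n + 1)).symm
    _ ≤ _ := ENNReal.ofReal_le_ofReal (sum_range_collisionProb_le hm N)
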